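/- Let G be a finitely generated nilpotent group, let H be a subgroup of G, and let X be a generating set of G such that for every x ∈ X some positive power of x lies in H. Then H has finite index in G, and moreover for every g ∈ G some positive power of g lies in H. -/

import Mathlib

open scoped commutatorElement

/-- In a finitely generated group, a subgroup containing the commutator subgroup and a positive
power of every element of a generating set has finite index. -/
theorem Subgroup.finiteIndex_of_commutator_le_of_pow_mem {G : Type*} [Group G] [Group.FG G]
    {K : Subgroup G} (hK : _root_.commutator G ≤ K) {X : Set G} (hX : Subgroup.closure X = ⊤)
    (hpow : ∀ x ∈ X, ∃ n : ℕ, 0 < n ∧ x ^ n ∈ K) : K.FiniteIndex := by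
  have hnormal : K.Normal := Subgroup.Normal.of_commutator_le G hK
  let _ : CommGroup (G ⧸ K) :=
    { (inferInstance : Group (G ⧸ K)) with
      mul_comm := (Subgroup.Normal.quotient_commutative_iff_commutator_le.2 hK).is_comm.comm }
  have htop : ⊤ ≤ (CommGroup.torsion (G ⧸ K)).comap (QuotientGroup.mk' K) := by
    rw [← hX, Subgroup.closure_le]
    intro x hx
    obtain ⟨n, hn, hxn⟩ := hpow x hx
    exact isOfFinOrder_iff_pow_eq_one.2 ⟨n, hn, (QuotientGroup.eq_one_iff (x ^ n)).2 hxn⟩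
  have htorsion : IsMulTorsion (G ⧸ K) := by
    intro q
    obtain ⟨g, rfl⟩ := QuotientGroup.mk'_surjective K q
    exact htop (Subgroup.mem_top g)
  have : Finite (G ⧸ K) := CommGroup.finite_of_fg_isMulTorsion _ htorsion
  exact Subgroup.finiteIndex_of_finite_quotient

/-- If `⁅x, y⁆` is central, then `⁅x, ·⁆` commutes with powers at `y`. -/
theorem commutatorElement_pow_right_of_mem_center {G : Type*} [Group G] {x y : G}
    (h : ⁅x, y⁆ ∈ Subgroup.center G) (n : ℕ) : ⁅x, y ^ n⁆ = ⁅x, y⁆ ^ n := by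
  have hconj : x * y * x⁻¹ = ⁅x, y⁆ * y := by simp [commutatorElement_def]
  have hcomm : Commute ⁅x, y⁆ y := (Subgroup.mem_center_iff.1 h y).symm
  rw [commutatorElement_def, ← conj_pow, hconj, hcomm.mul_pow, mul_inv_cancel_right]

/-- If `⁅x, y⁆` is central, then `⁅·, y⁆` commutes with powers at `x`. -/
theorem commutatorElement_pow_left_of_mem_center {G : Type*} [Group G] {x y : G}
    (h : ⁅x, y⁆ ∈ Subgroup.center G) (n : ℕ) : ⁅x ^ n, y⁆ = ⁅x, y⁆ ^ n := by
  have h' : ⁅y, x⁆ ∈ Subgroup.center G := by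
    rw [← commutatorElement_inv]
    exact inv_mem h
  rw [← commutatorElement_inv, commutatorElement_pow_right_of_mem_center h', ← inv_pow,
    commutatorElement_inv]

/-- A subgroup of the center is normal. -/
theorem Subgroup.normal_of_le_center {G : Type*} [Group G] {Z : Subgroup G}
    (hZ : Z ≤ Subgroup.center G) : Z.Normal where
  conj_mem z hz g := by rwa [Subgroup.mem_center_iff.1 (hZ hz) g, mul_inv_cancel_right]

/-- Commutators of elements of `H ⊔ Z` lie in `H` when `Z` is central. -/
theorem Subgroup.commutatorElement_mem_of_mem_sup_of_le_center {G : Type*} [Group G]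
    {H Z : Subgroup G} (hZ : Z ≤ Subgroup.center G) {x y : G} (hx : x ∈ H ⊔ Z) (hy : y ∈ H ⊔ Z) :
    ⁅x, y⁆ ∈ H := by
  have : Z.Normal := Subgroup.normal_of_le_center hZ
  obtain ⟨h, hh, z, hz, rfl⟩ := Subgroup.mem_sup_of_normal_right.1 hx
  obtain ⟨k, hk, w, hw, rfl⟩ := Subgroup.mem_sup_of_normal_right.1 hy
  have hz' := Subgroup.mem_center_iff.1 (hZ hz)
  have hw' := Subgroup.mem_center_iff.1 (hZ hw)
  have : ⁅h * z, k * w⁆ = ⁅h, k⁆ := by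
    simp only [commutatorElement_def]
    rw [mul_inv_eq_iff_eq_mul, mul_inv_eq_iff_eq_mul, mul_assoc h z, ← hz' (k * w)]
    simp only [mul_assoc]
    rw [← hw' (h * z)]
    simp [mul_assoc, hz' w]
  rw [this]
  exact Subgroup.commutator_le_self H (Subgroup.commutator_mem_commutator hh hk)

/-- In a finitely generated group, if `⁅A, ⊤⁆` is central and `H ⊔ ⁅A, ⊤⁆` has finite index,
then `H` has finite index. -/
theorem Subgroup.finiteIndex_of_sup_commutator_top {G : Type*} [Group G] [Group.FG G]
    {H A : Subgroup G} (hcenter : ⁅A, (⊤ : Subgroup G)⁆ ≤ Subgroup.center G)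
    (hindex : (H ⊔ ⁅A, (⊤ : Subgroup G)⁆).FiniteIndex) : H.FiniteIndex := by
  have hnormal : ⁅A, (⊤ : Subgroup G)⁆.Normal := Subgroup.normal_of_le_center hcenter
  have hpow : ∀ z ∈ ⁅A, (⊤ : Subgroup G)⁆, ∃ n : ℕ, 0 < n ∧ z ^ n ∈ H := by
    intro z hz
    rw [Subgroup.commutator_def] at hz
    induction hz using Subgroup.closure_induction with
    | mem z hz =>
      obtain ⟨a, ha, g, hg, rfl⟩ := hz
      have hag := hcenter (Subgroup.commutator_mem_commutator ha hg)
      obtain ⟨m, hm, -, ham⟩ := Subgroup.exists_pow_mem_of_index_ne_zero hindex.index_ne_zero a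
      obtain ⟨n, hn, -, hgn⟩ := Subgroup.exists_pow_mem_of_index_ne_zero hindex.index_ne_zero g
      refine ⟨n * m, Nat.mul_pos hn hm, ?_⟩
      have hagn : ⁅a, g ^ n⁆ ∈ Subgroup.center G := by
        rw [commutatorElement_pow_right_of_mem_center hag]
        exact pow_mem hag n
      rw [pow_mul, ← commutatorElement_pow_right_of_mem_center hag,
        ← commutatorElement_pow_left_of_mem_center hagn]
      exact Subgroup.commutatorElement_mem_of_mem_sup_of_le_center hcenter ham hgn
    | one => exact ⟨1, one_pos, by simp⟩
    | mul x y hx _ ihx ihy =>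
      obtain ⟨m, hm, hxm⟩ := ihx
      obtain ⟨n, hn, hyn⟩ := ihy
      have hcomm : Commute x y := (Subgroup.mem_center_iff.1 (hcenter hx) y).symm
      refine ⟨m * n, Nat.mul_pos hm hn, ?_⟩
      rw [hcomm.mul_pow, pow_mul, mul_comm m n, pow_mul]
      exact mul_mem (pow_mem hxm n) (pow_mem hyn m)
    | inv x _ ih =>
      obtain ⟨n, hn, hxn⟩ := ih
      exact ⟨n, hn, by simpa using hxn⟩
  set L := H ⊔ ⁅A, (⊤ : Subgroup G)⁆
  have hfinite : (H.subgroupOf L).FiniteIndex := by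
    refine Subgroup.finiteIndex_of_commutator_le_of_pow_mem ?_ Subgroup.closure_univ ?_
    · rw [_root_.commutator_def, Subgroup.commutator_le]
      rintro x - y -
      exact Subgroup.commutatorElement_mem_of_mem_sup_of_le_center hcenter x.2 y.2
    · rintro ⟨x, hx⟩ -
      obtain ⟨h, hh, z, hz, rfl⟩ := Subgroup.mem_sup_of_normal_right.1 hx
      obtain ⟨n, hn, hzn⟩ := hpow z hz
      have hcomm : Commute h z := Subgroup.mem_center_iff.1 (hcenter hz) h
      refine ⟨n, hn, ?_⟩
      change (h * z) ^ n ∈ H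
      rw [hcomm.mul_pow]
      exact mul_mem (pow_mem hh n) hzn
  refine ⟨?_⟩
  rw [← Subgroup.relIndex_mul_index (le_sup_left : H ≤ L)]
  exact mul_ne_zero hfinite.index_ne_zero hindex.index_ne_zero

/-- If a subgroup of a finitely generated group contains a positive power of every element of a
generating set, then it has finite index modulo each term of the lower central series. -/
theorem Subgroup.finiteIndex_sup_lowerCentralSeries {G : Type*} [Group G] [Group.FG G]
    {H : Subgroup G} {X : Set G} (hX : Subgroup.closure X = ⊤)
    (hpow : ∀ x ∈ X, ∃ n : ℕ, 0 < n ∧ x ^ n ∈ H) (n : ℕ) :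
    (H ⊔ (⊤ : Subgroup G).lowerCentralSeries (n + 1)).FiniteIndex := by
  induction n with
  | zero =>
    refine Subgroup.finiteIndex_of_commutator_le_of_pow_mem ?_ hX fun x hx ↦ ?_
    · rw [zero_add, Subgroup.top_lowerCentralSeries_one]
      exact le_sup_right
    · obtain ⟨n, hn, hxn⟩ := hpow x hx
      exact ⟨n, hn, Subgroup.mem_sup_left hxn⟩
  | succ n ih =>
    set N := (⊤ : Subgroup G).lowerCentralSeries (n + 2)
    set f := QuotientGroup.mk' N with hf
    have hsurj : Function.Surjective f := QuotientGroup.mk'_surjective N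
    have hmap : ⁅((⊤ : Subgroup G).lowerCentralSeries n).map f, (⊤ : Subgroup (G ⧸ N))⁆ =
        ((⊤ : Subgroup G).lowerCentralSeries (n + 1)).map f := by
      rw [Subgroup.lowerCentralSeries_succ, Subgroup.map_commutator,
        Subgroup.map_top_of_surjective f hsurj]
    have hcenter : ⁅((⊤ : Subgroup G).lowerCentralSeries n).map f, (⊤ : Subgroup (G ⧸ N))⁆ ≤
        Subgroup.center (G ⧸ N) := by
      rw [hmap, ← Subgroup.centralizer_univ, ← Subgroup.coe_top,
        ← Subgroup.commutator_eq_bot_iff_le_centralizer, ← Subgroup.map_top_of_surjective f hsurj,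
        ← Subgroup.map_commutator, ← Subgroup.lowerCentralSeries_succ, Subgroup.map_eq_bot_iff,
        hf, QuotientGroup.ker_mk']
    have hindex : (H.map f).FiniteIndex := by
      refine Subgroup.finiteIndex_of_sup_commutator_top hcenter ?_
      rw [hmap, ← Subgroup.map_sup]
      exact ⟨fun h ↦ ih.index_ne_zero
        (Nat.eq_zero_of_zero_dvd (h ▸ Subgroup.index_map_dvd _ hsurj))⟩
    have hcomap : (H.map f).comap f = H ⊔ N := by
      rw [Subgroup.comap_map_eq, hf, QuotientGroup.ker_mk']
    rw [← hcomap]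
    exact ⟨by rw [Subgroup.index_comap_of_surjective _ hsurj]; exact hindex.index_ne_zero⟩

/-- **Lemma.** If `G` is a finitely generated nilpotent group, `H ≤ G`, and some positive
power of each element of a generating set `X` of `G` lies in `H`, then `H` has finite index
in `G` and a positive power of every element of `G` lies in `H`. -/
theorem finiteIndex_of_pow_mem_of_generators {G : Type*} [Group G]
    (hfg : Group.FG G) (hnil : Group.IsNilpotent G) (H : Subgroup G)
    (X : Set G) (hX : Subgroup.closure X = ⊤)
    (hpow : ∀ x ∈ X, ∃ n : ℕ, 0 < n ∧ x ^ n ∈ H) :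
    H.FiniteIndex ∧ ∀ g : G, ∃ n : ℕ, 0 < n ∧ g ^ n ∈ H := by
  have hindex : H.FiniteIndex := by
    obtain ⟨n, hn⟩ := Subgroup.nilpotent_iff_lowerCentralSeries.1 hnil
    have hbot : (⊤ : Subgroup G).lowerCentralSeries (n + 1) = ⊥ :=
      le_bot_iff.1 (hn ▸ Subgroup.lowerCentralSeries_antitone ⊤ n.le_succ)
    have hsup := Subgroup.finiteIndex_sup_lowerCentralSeries hX hpow n
    rwa [hbot, sup_bot_eq] at hsup
  refine ⟨hindex, fun g ↦ ?_⟩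
  obtain ⟨n, hn, -, hgn⟩ := Subgroup.exists_pow_mem_of_index_ne_zero hindex.index_ne_zero g
  exact ⟨n, hn, hgn⟩
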